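/- There is an absolute constant C > 0 such that the following holds. Let d be even, let f be a homogeneous polynomial of degree d in n real variables, and let {f_{2α}} be its multilinear components. If κ ≥ 0 is such that Λ(f_{2α}) ≤ κ·‖f_{2α}‖₂ for every multi-index α with |α| ≤ d/2 and f_{2α} ≠ 0, then Λ(f) ≤ C^d · κ · ‖f‖₂. -/

import Mathlib

open MvPolynomial

/-- `‖f‖₂ = sup_{‖x‖₂ = 1} |f(x)|` for a polynomial `f` in `n` real variables. -/
noncomputable def sphereNorm {n : ℕ} (f : MvPolynomial (Fin n) ℝ) : ℝ :=
  sSup {y | ∃ x : Fin n → ℝ, (∑ i, x i ^ 2) = 1 ∧ y = |eval x f|}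

/-- `M` is a (symmetric) matrix representation of the polynomial `h`, where rows and
columns are indexed by tuples `I ∈ [n]^k` (with `2k` the degree of `h`). -/
def IsMatrixRepr {n : ℕ} (k : ℕ) (M : Matrix (Fin k → Fin n) (Fin k → Fin n) ℝ)
    (h : MvPolynomial (Fin n) ℝ) : Prop :=
  M.IsSymm ∧ ∀ x : Fin n → ℝ,
    (∑ I : Fin k → Fin n, ∑ J : Fin k → Fin n,
      M I J * (∏ t, x (I t)) * (∏ t, x (J t))) = eval x h

/-- `sup_{‖z‖₂=1} zᵀ M z`, the maximum eigenvalue of the symmetric matrix `M`. -/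
noncomputable def maxEig {n k : ℕ} (M : Matrix (Fin k → Fin n) (Fin k → Fin n) ℝ) : ℝ :=
  sSup {y | ∃ z : (Fin k → Fin n) → ℝ, (∑ I, z I ^ 2) = 1 ∧
    y = ∑ I, ∑ J, z I * M I J * z J}

/-- `Λ(h)`: the infimum over matrix representations `M` of `h` of the maximum
eigenvalue of `M`; `k` is half the degree of `h`. -/
noncomputable def Lam {n : ℕ} (k : ℕ) (h : MvPolynomial (Fin n) ℝ) : ℝ :=
  sInf {y | ∃ M : Matrix (Fin k → Fin n) (Fin k → Fin n) ℝ, IsMatrixRepr k M h ∧ y = maxEig M}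


/-- A polynomial is multilinear if every variable appears with degree at most 1
in every monomial with nonzero coefficient. -/
def IsMultilinear {n : ℕ} (p : MvPolynomial (Fin n) ℝ) : Prop :=
  ∀ m ∈ p.support, ∀ i, m i ≤ 1

/-- `|α| = Σᵢ αᵢ`, the total degree of the multi-index `α`. -/
def mdeg {n : ℕ} (α : Fin n →₀ ℕ) : ℕ := α.sum fun _ e => e

/-- `g` is the multilinear decomposition of the degree-`d` homogeneous polynomial `f`,
i.e. `f = Σ_{|α| ≤ d/2} g α · x^{2α}` where each `g α` is multilinear and homogeneous
of degree `d - 2|α|`. -/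
def IsMLDecomp {n : ℕ} (d : ℕ) (f : MvPolynomial (Fin n) ℝ)
    (g : (Fin n →₀ ℕ) → MvPolynomial (Fin n) ℝ) : Prop :=
  (∀ α : Fin n →₀ ℕ,
      (mdeg α ≤ d / 2 → IsMultilinear (g α) ∧ (g α).IsHomogeneous (d - 2 * mdeg α)) ∧
      (d / 2 < mdeg α → g α = 0)) ∧
  f = ∑ᶠ α : Fin n →₀ ℕ, g α * monomial (2 • α) (1 : ℝ)

/-- `|𝒪(α)| = |α|! / ∏ᵢ αᵢ!`, the number of tuples corresponding to `α`. -/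
noncomputable def orbitCard {n : ℕ} (α : Fin n →₀ ℕ) : ℝ :=
  (Nat.factorial (mdeg α) : ℝ) / α.prod fun _ e => (Nat.factorial e : ℝ)


lemma aux_bdd {n : ℕ} (f : MvPolynomial (Fin n) ℝ) :
    BddAbove {y | ∃ x : Fin n → ℝ, (∑ i, x i ^ 2) = 1 ∧ y = |eval x f|} := by
  refine ⟨∑ m ∈ f.support, |f.coeff m|, ?_⟩
  rintro y ⟨x, hx, rfl⟩
  rw [eval_eq']
  refine (Finset.abs_sum_le_sum_abs _ _).trans (Finset.sum_le_sum fun m _ => ?_)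
  rw [abs_mul, Finset.abs_prod]
  refine mul_le_of_le_one_right (abs_nonneg _) ?_
  refine Finset.prod_le_one (fun i _ => abs_nonneg _) fun i _ => ?_
  rw [abs_pow]
  refine pow_le_one₀ (abs_nonneg _) ?_
  rw [← sq_le_one_iff_abs_le_one, ← hx]
  exact Finset.single_le_sum (f := fun i => x i ^ 2) (fun i _ => sq_nonneg _) (Finset.mem_univ i)

lemma aux_sphere_nonneg {n : ℕ} (f : MvPolynomial (Fin n) ℝ) : 0 ≤ sphereNorm f := by
  apply Real.sSup_nonneg
  rintro y ⟨x, hx, rfl⟩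
  exact abs_nonneg _

lemma aux_le_sphere {n : ℕ} (f : MvPolynomial (Fin n) ℝ) (x : Fin n → ℝ)
    (hx : (∑ i, x i ^ 2) = 1) : |eval x f| ≤ sphereNorm f :=
  le_csSup (aux_bdd f) ⟨x, hx, rfl⟩

lemma aux_hom_aeval {n d : ℕ} {A : Type*} [CommRing A] [Algebra ℝ A]
    (f : MvPolynomial (Fin n) ℝ) (hf : f.IsHomogeneous d) (c : A) (x : Fin n → A) :
    aeval (fun i => c * x i) f = c ^ d * aeval x f := by
  rw [aeval_def, aeval_def, eval₂_eq', eval₂_eq', Finset.mul_sum]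
  refine Finset.sum_congr rfl fun m hm => ?_
  have h1 : ∑ i, m i = d := by
    have := hf.degree_eq_sum_deg_support hm
    rw [this]
    exact (Finset.sum_subset (Finset.subset_univ _) (by intro i _ hi; simpa using hi)).symm
  simp_rw [mul_pow]
  rw [Finset.prod_mul_distrib, Finset.prod_pow_eq_pow_sum, h1]
  ring

lemma aux_hom_eval {n d : ℕ} (f : MvPolynomial (Fin n) ℝ) (hf : f.IsHomogeneous d) (c : ℝ)
    (x : Fin n → ℝ) : eval (fun i => c * x i) f = c ^ d * eval x f := by
  have := aux_hom_aeval f hf c x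
  simpa [MvPolynomial.aeval_eq_eval] using this

lemma aux_le_sphere' {n k : ℕ} (f : MvPolynomial (Fin n) ℝ) (hf : f.IsHomogeneous (2 * k))
    (e : Fin n → ℝ) (he : (∑ i, e i ^ 2) = 1) (x : Fin n → ℝ) :
    |eval x f| ≤ sphereNorm f * (∑ i, x i ^ 2) ^ k := by
  by_cases h0 : ∑ i, x i ^ 2 = 0
  · have hx : x = fun i => 0 * e i := by
      funext i
      have := (Finset.sum_eq_zero_iff_of_nonneg (fun i _ => sq_nonneg (x i))).1 h0 i
        (Finset.mem_univ i)
      simpa using this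
    have h1 : eval x f = 0 ^ (2 * k) * eval e f := by rw [hx, aux_hom_eval f hf]
    rw [h1, h0, abs_mul, abs_pow, abs_zero, pow_mul, mul_comm]
    rw [show (0:ℝ)^2 = 0 by norm_num]
    exact mul_le_mul_of_nonneg_right (aux_le_sphere f e he) (by positivity)
  · have hpos : 0 < ∑ i, x i ^ 2 :=
      lt_of_le_of_ne (Finset.sum_nonneg fun i _ => sq_nonneg _) (Ne.symm h0)
    set s := ∑ i, x i ^ 2 with hs
    have hsq : √s ^ 2 = s := Real.sq_sqrt hpos.le
    have hsp : 0 < √s := Real.sqrt_pos.2 hpos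
    have hx : x = fun i => √s * (x i / √s) := by
      funext i; field_simp
    have hu : ∑ i, (x i / √s) ^ 2 = 1 := by
      simp_rw [div_pow]
      rw [← Finset.sum_div, hsq, ← hs, div_self h0]
    have h1 : eval x f = √s ^ (2 * k) * eval (fun i => x i / √s) f := by
      conv_lhs => rw [hx]
      rw [aux_hom_eval f hf]
    rw [h1, pow_mul, hsq, abs_mul, abs_of_nonneg (by positivity), mul_comm]
    exact mul_le_mul_of_nonneg_right (aux_le_sphere f _ hu) (by positivity)

lemma aux_complex {n k : ℕ} (f : MvPolynomial (Fin n) ℝ) (hf : f.IsHomogeneous (2 * k))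
    (e : Fin n → ℝ) (he : (∑ i, e i ^ 2) = 1) (z : Fin n → ℂ) (R : ℝ)
    (hz : ∑ i, ‖z i‖ ^ 2 ≤ R) :
    ‖aeval z f‖ ≤ 4 ^ k * sphereNorm f * R ^ k := by
  let P : ℂ → ℂ := fun η => aeval (fun i => z i + η * (starRingEnd ℂ) (z i)) f
  have hP : Differentiable ℂ P := by
    have : P = fun η => ∑ m ∈ f.support, algebraMap ℝ ℂ (f.coeff m) *
        ∏ i, (z i + η * (starRingEnd ℂ) (z i)) ^ m i := by
      funext η
      simp only [P]
      rw [aeval_def, eval₂_eq']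
    rw [this]
    fun_prop
  have h0 : aeval z f = P 0 := by simp [P]
  rw [h0]
  refine Complex.norm_le_of_forall_mem_frontier_norm_le (U := Metric.ball (0:ℂ) 1)
    Metric.isBounded_ball hP.diffContOnCl ?_ (subset_closure (by simp))
  intro η hη
  rw [frontier_ball _ one_ne_zero] at hη
  have hη1 : ‖η‖ = 1 := by simpa using hη
  obtain ⟨w, hw⟩ := IsAlgClosed.exists_pow_nat_eq η (n := 2) (by norm_num)
  have hw1 : ‖w‖ = 1 := by
    have : ‖w‖ ^ 2 = 1 := by rw [← norm_pow, hw, hη1]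
    nlinarith [norm_nonneg w]
  have hww : w * (starRingEnd ℂ) w = 1 := by
    rw [Complex.mul_conj, Complex.normSq_eq_norm_sq, hw1]; simp
  let x : Fin n → ℝ := fun i => 2 * ((starRingEnd ℂ) w * z i).re
  have hx : (fun i => z i + η * (starRingEnd ℂ) (z i)) = fun i => w * ((x i : ℝ) : ℂ) := by
    funext i
    have : ((x i : ℝ) : ℂ) = (starRingEnd ℂ) w * z i + w * (starRingEnd ℂ) (z i) := by
      simp only [x]
      have h := Complex.add_conj ((starRingEnd ℂ) w * z i)
      simp only [map_mul, Complex.conj_conj] at h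
      rw [h]
    rw [this, ← hw]
    linear_combination (-z i) * hww
  have hre : aeval (fun i => ((x i : ℝ) : ℂ)) f = ((eval x f : ℝ) : ℂ) := by
    rw [aeval_def, eval₂_eq', eval_eq']
    push_cast
    rfl
  have hPη : P η = w ^ (2 * k) * ((eval x f : ℝ) : ℂ) := by
    simp only [P]
    rw [hx, aux_hom_aeval f hf, hre]
  rw [hPη, norm_mul, norm_pow, hw1, one_pow, one_mul, Complex.norm_real, Real.norm_eq_abs]
  refine (aux_le_sphere' f hf e he x).trans ?_
  have hsum : ∑ i, x i ^ 2 ≤ 4 * R := by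
    refine le_trans ?_ (mul_le_mul_of_nonneg_left hz (by norm_num))
    rw [Finset.mul_sum]
    refine Finset.sum_le_sum fun i _ => ?_
    have : |((starRingEnd ℂ) w * z i).re| ≤ ‖z i‖ := by
      refine (Complex.abs_re_le_norm _).trans ?_
      rw [norm_mul, RCLike.norm_conj, hw1, one_mul]
    have h2 := sq_le_sq' (by linarith [abs_nonneg ((starRingEnd ℂ) w * z i).re, norm_nonneg (z i)] : -‖z i‖ ≤ |((starRingEnd ℂ) w * z i).re|) this
    rw [sq_abs] at h2
    simp only [x]
    nlinarith
  calc sphereNorm f * (∑ i, x i ^ 2) ^ k ≤ sphereNorm f * (4 * R) ^ k := by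
        refine mul_le_mul_of_nonneg_left ?_ (aux_sphere_nonneg f)
        exact pow_le_pow_left₀ (Finset.sum_nonneg fun i _ => sq_nonneg _) hsum k
    _ = 4 ^ k * sphereNorm f * R ^ k := by rw [mul_pow]; ring

lemma aux_roots (N : ℕ) (hN : 0 < N) (ζ : ℂ) (hζ : IsPrimitiveRoot ζ N) (j : ℕ) :
    (1 / (N : ℂ)) * ∑ s : Fin N, (ζ ^ (s : ℕ)) ^ j = if N ∣ j then 1 else 0 := by
  have hN' : (N : ℂ) ≠ 0 := by exact_mod_cast hN.ne'
  rw [Fin.sum_univ_eq_sum_range (fun s => (ζ ^ s) ^ j) N]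
  simp_rw [← pow_mul, mul_comm _ j, pow_mul]
  split_ifs with h
  · rw [(hζ.pow_eq_one_iff_dvd j).2 h]
    simp [hN']
  · have h1 : ζ ^ j ≠ 1 := fun h' => h ((hζ.pow_eq_one_iff_dvd j).1 h')
    rw [geom_sum_eq h1, ← pow_mul, mul_comm j, pow_mul, hζ.pow_eq_one]
    simp

/-- one-coordinate extraction measure -/
lemma aux_coord (D a : ℕ) (ha : 2 * a ≤ D) (r c y : ℝ) (hc : |c| ≤ 1 / 2) (hy : y = r * c)
    (N : ℕ) (hN : N = D + 5) :
    ∃ (z u : Fin N → ℂ), (∀ s, ‖z s‖ = |r|) ∧ (∑ s, ‖u s‖ ≤ 2 ^ a) ∧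
      ∀ m ≤ D + 1, ∑ s, u s * z s ^ m =
        (r : ℂ) ^ (2 * a) * ((if m = 2 * a then 1 else 0) + if m = 2 * a + 1 then (y : ℂ) else 0) := by
  have hN0 : N ≠ 0 := by omega
  have hNc : (N : ℂ) ≠ 0 := by exact_mod_cast hN0
  have hNr : (0 : ℝ) < N := by exact_mod_cast Nat.pos_of_ne_zero hN0
  obtain ⟨ζ, hζ⟩ : ∃ ζ : ℂ, IsPrimitiveRoot ζ N := ⟨_, Complex.isPrimitiveRoot_exp N hN0⟩
  have hζn : ‖ζ‖ = 1 := hζ.norm'_eq_one hN0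
  have hroot := aux_roots N (Nat.pos_of_ne_zero hN0) ζ hζ
  have hz : ∀ s : Fin N, ‖(r : ℂ) * ζ ^ (s : ℕ)‖ = |r| := by
    intro s; rw [norm_mul, norm_pow, hζn]; simp
  rcases Nat.eq_zero_or_pos a with h0 | h0
  · subst h0
    refine ⟨fun s => r * ζ ^ (s : ℕ), fun s => (1 / (N : ℂ)) *
      (1 + c * (ζ ^ (s : ℕ)) ^ (N - 1) + c * ζ ^ (s : ℕ)), hz, ?_, ?_⟩
    · have hreal : ∀ s : Fin N, 1 + (c : ℂ) * (ζ ^ (s : ℕ)) ^ (N - 1) + c * ζ ^ (s : ℕ) =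
          ((1 + 2 * c * (ζ ^ (s : ℕ)).re : ℝ) : ℂ) := by
        intro s
        have h1 : (ζ ^ (s : ℕ)) ^ (N - 1) = (starRingEnd ℂ) (ζ ^ (s : ℕ)) := by
          have hne : ζ ^ (s : ℕ) ≠ 0 := by
            intro h; have := congrArg norm h; rw [norm_pow, hζn] at this; simp at this
          apply mul_left_cancel₀ hne
          rw [← pow_succ', Nat.sub_add_cancel (by omega), ← pow_mul, mul_comm, pow_mul,
            hζ.pow_eq_one, one_pow, Complex.mul_conj, Complex.normSq_eq_norm_sq, norm_pow, hζn]
          simp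
        have h2 := Complex.add_conj (ζ ^ (s : ℕ))
        rw [h1]
        push_cast at h2 ⊢
        linear_combination (c : ℂ) * h2
      have hnn : ∀ s : Fin N, 0 ≤ 1 + 2 * c * (ζ ^ (s : ℕ)).re := by
        intro s
        have h1 : |(ζ ^ (s : ℕ)).re| ≤ 1 := by
          refine (Complex.abs_re_le_norm _).trans ?_
          rw [norm_pow, hζn, one_pow]
        have h2 : |c * (ζ ^ (s : ℕ)).re| ≤ 1 / 2 := by
          rw [abs_mul]
          calc _ ≤ 1 / 2 * (1:ℝ) := mul_le_mul hc h1 (abs_nonneg _) (by norm_num)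
            _ = _ := by norm_num
        have := neg_abs_le (c * (ζ ^ (s : ℕ)).re)
        nlinarith
      have hsum : ((∑ s : Fin N, (1 / (N:ℝ)) * (1 + 2 * c * (ζ ^ (s : ℕ)).re) : ℝ) : ℂ) = 1 := by
        push_cast
        have e1 := hroot (N - 1)
        have e2 := hroot 1
        rw [if_neg (fun h => by have := Nat.le_of_dvd (by omega) h; omega)] at e1
        rw [if_neg (fun h => by have := Nat.le_of_dvd (by omega) h; omega)] at e2
        have e3 : ∀ s : Fin N, 1 / (N : ℂ) * (1 + 2 * (c:ℂ) * ((ζ ^ (s : ℕ)).re : ℂ)) =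
            1 / (N:ℂ) + c * ((1 / (N:ℂ)) * (ζ ^ (s : ℕ)) ^ (N - 1)) +
              c * ((1 / (N:ℂ)) * (ζ ^ (s : ℕ)) ^ 1) := by
          intro s
          have := hreal s
          push_cast at this
          rw [← this]; ring
        rw [Finset.sum_congr rfl fun s _ => e3 s, Finset.sum_add_distrib, Finset.sum_add_distrib,
          ← Finset.mul_sum, ← Finset.mul_sum, ← Finset.mul_sum, ← Finset.mul_sum, e1, e2]
        simp [hNc]
      have hsum' : ∑ s : Fin N, (1 / (N:ℝ)) * (1 + 2 * c * (ζ ^ (s : ℕ)).re) = 1 := by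
        exact_mod_cast hsum
      rw [pow_zero, ← hsum']
      refine Finset.sum_le_sum fun s _ => ?_
      beta_reduce
      rw [hreal s, norm_mul, Complex.norm_real, Real.norm_eq_abs, abs_of_nonneg (hnn s)]
      simp
    · intro m hm
      have e1 := hroot m
      have e2 := hroot (N - 1 + m)
      have e3 := hroot (m + 1)
      have i1 : (N ∣ m) ↔ m = 0 := by
        constructor
        · intro h; by_contra h'; have := Nat.le_of_dvd (by omega) h; omega
        · rintro rfl; simp
      have i2 : (N ∣ N - 1 + m) ↔ m = 1 := by
        constructor
        · rintro ⟨q, hq⟩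
          have h1 : q < 2 := by
            by_contra h'
            have : N * 2 ≤ N * q := Nat.mul_le_mul_left _ (by omega)
            omega
          interval_cases q <;> omega
        · rintro rfl; rw [Nat.sub_add_cancel (by omega)]
      have i3 : ¬ (N ∣ m + 1) := by
        intro h; have := Nat.le_of_dvd (by omega) h; omega
      simp only [i1] at e1
      simp only [i2] at e2
      rw [if_neg i3] at e3
      have : ∀ s : Fin N, (1 / (N : ℂ)) *
          (1 + c * (ζ ^ (s : ℕ)) ^ (N - 1) + c * ζ ^ (s : ℕ)) * (r * ζ ^ (s : ℕ)) ^ m =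
          (r:ℂ) ^ m * ((1 / (N : ℂ)) * (ζ ^ (s : ℕ)) ^ m) +
          (r:ℂ) ^ m * c * ((1 / (N : ℂ)) * (ζ ^ (s : ℕ)) ^ (N - 1 + m)) +
          (r:ℂ) ^ m * c * ((1 / (N : ℂ)) * (ζ ^ (s : ℕ)) ^ (m + 1)) := by
        intro s; rw [mul_pow, pow_add, pow_succ]; ring
      rw [Finset.sum_congr rfl fun s _ => this s, Finset.sum_add_distrib, Finset.sum_add_distrib]
      simp only [← Finset.mul_sum]
      rw [e1, e2, e3, hy]
      rcases eq_or_ne m 0 with rfl | h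
      · simp
      · rcases eq_or_ne m 1 with rfl | h'
        · simp
        · simp [h, h']
  · refine ⟨fun s => r * ζ ^ (s : ℕ), fun s => (1 / (N : ℂ)) *
      ((ζ ^ (s : ℕ)) ^ (N - 2 * a) + c * (ζ ^ (s : ℕ)) ^ (N - 2 * a - 1)), hz, ?_, ?_⟩
    · have h1 : ∀ s : Fin N, ‖(1 / (N : ℂ)) *
          ((ζ ^ (s : ℕ)) ^ (N - 2 * a) + c * (ζ ^ (s : ℕ)) ^ (N - 2 * a - 1))‖ ≤ (1 / (N:ℝ)) * 2 := by
        intro s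
        rw [norm_mul]
        have : ‖(1 / (N : ℂ))‖ = 1 / (N:ℝ) := by simp
        rw [this]
        refine mul_le_mul_of_nonneg_left ?_ (by positivity)
        refine (norm_add_le _ _).trans ?_
        simp only [norm_mul, norm_pow, hζn, one_pow, Complex.norm_real, Real.norm_eq_abs]
        linarith
      refine (Finset.sum_le_sum fun s _ => h1 s).trans ?_
      rw [Finset.sum_const, Finset.card_univ, Fintype.card_fin, nsmul_eq_mul]
      have : (2:ℝ) ^ 1 ≤ 2 ^ a := pow_le_pow_right₀ (by norm_num) h0
      have h3 : (N:ℝ) * (1 / N * 2) = 2 := by field_simp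
      rw [h3]; linarith
    · intro m hm
      have e1 := hroot (N - 2 * a + m)
      have e2 := hroot (N - 2 * a - 1 + m)
      have i1 : (N ∣ N - 2 * a + m) ↔ m = 2 * a := by
        constructor
        · rintro ⟨q, hq⟩
          have h1 : q < 2 := by
            by_contra h'
            have : N * 2 ≤ N * q := Nat.mul_le_mul_left _ (by omega)
            omega
          interval_cases q <;> omega
        · rintro rfl; rw [Nat.sub_add_cancel (by omega)]
      have i2 : (N ∣ N - 2 * a - 1 + m) ↔ m = 2 * a + 1 := by
        constructor
        · rintro ⟨q, hq⟩
          have h1 : q < 2 := by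
            by_contra h'
            have : N * 2 ≤ N * q := Nat.mul_le_mul_left _ (by omega)
            omega
          interval_cases q <;> omega
        · rintro rfl; rw [show N - 2 * a - 1 + (2 * a + 1) = N by omega]
      simp only [i1] at e1
      simp only [i2] at e2
      have : ∀ s : Fin N, (1 / (N : ℂ)) *
          ((ζ ^ (s : ℕ)) ^ (N - 2 * a) + c * (ζ ^ (s : ℕ)) ^ (N - 2 * a - 1)) * (r * ζ ^ (s : ℕ)) ^ m =
          (r:ℂ) ^ m * ((1 / (N : ℂ)) * (ζ ^ (s : ℕ)) ^ (N - 2 * a + m)) +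
          (r:ℂ) ^ m * c * ((1 / (N : ℂ)) * (ζ ^ (s : ℕ)) ^ (N - 2 * a - 1 + m)) := by
        intro s; rw [mul_pow, pow_add, pow_add]; ring
      rw [Finset.sum_congr rfl fun s _ => this s, Finset.sum_add_distrib]
      simp only [← Finset.mul_sum]
      rw [e1, e2, hy]
      rcases eq_or_ne m (2 * a) with rfl | h
      · simp
      · rcases eq_or_ne m (2 * a + 1) with rfl | h'
        · simp [pow_succ]; ring
        · simp [h, h']

lemma aux_mdeg {n : ℕ} (α : Fin n →₀ ℕ) : mdeg α = ∑ i, α i :=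
  Finsupp.sum_fintype _ _ (fun _ => rfl)

noncomputable def auxS (n k : ℕ) : Finset (Fin n →₀ ℕ) :=
  (Finsupp.finite_of_degree_le (σ := Fin n) k).toFinset

lemma aux_memS {n k : ℕ} (α : Fin n →₀ ℕ) : α ∈ auxS n k ↔ mdeg α ≤ k := by
  simp only [auxS, Set.Finite.mem_toFinset, Set.mem_ofPred_eq]
  rfl

lemma aux_dec {n k : ℕ} {f : MvPolynomial (Fin n) ℝ} {g : (Fin n →₀ ℕ) → MvPolynomial (Fin n) ℝ}
    (h : IsMLDecomp (2 * k) f g) : f = ∑ β ∈ auxS n k, g β * monomial (2 • β) (1 : ℝ) := by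
  rw [h.2]
  refine finsum_eq_sum_of_support_subset _ ?_
  intro β hβ
  rw [Finset.mem_coe, aux_memS]
  by_contra hh
  apply hβ
  have := (h.1 β).2 (by omega)
  simp [this]

lemma aux_extract {n k : ℕ} {f : MvPolynomial (Fin n) ℝ}
    {g : (Fin n →₀ ℕ) → MvPolynomial (Fin n) ℝ} (hf : f.IsHomogeneous (2 * k))
    (h : IsMLDecomp (2 * k) f g) (α : Fin n →₀ ℕ) (hα : mdeg α ≤ k) (y r c : Fin n → ℝ)
    (hy1 : ∑ i, y i ^ 2 = 1) (hy : ∀ i, y i = r i * c i) (hc : ∀ i, |c i| ≤ 1 / 2)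
    (hr : ∑ i, r i ^ 2 ≤ 5) :
    |eval y (g α)| * ∏ i, (r i ^ 2) ^ α i ≤ 2 ^ mdeg α * (4 ^ k * sphereNorm f * 5 ^ k) := by
  have hle : ∀ β : Fin n →₀ ℕ, mdeg β ≤ k → ∀ i, β i ≤ k := by
    intro β hβ i
    rw [aux_mdeg] at hβ
    exact (Finset.single_le_sum (f := fun i => β i) (fun i _ => Nat.zero_le _)
      (Finset.mem_univ i)).trans hβ
  have hex := fun i => aux_coord (2 * k) (α i) (by have := hle α hα i; omega) (r i) (c i) (y i)
    (hc i) (hy i) (2 * k + 5) rfl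
  choose z u hz hu hm using hex
  let L : MvPolynomial (Fin n) ℝ →ₗ[ℝ] ℂ := ∑ s : Fin n → Fin (2 * k + 5),
    (LinearMap.mulLeft ℝ (∏ i, u i (s i))).comp (aeval (fun i => z i (s i))).toLinearMap
  have hL : ∀ p, L p = ∑ s : Fin n → Fin (2 * k + 5),
      (∏ i, u i (s i)) * aeval (fun i => z i (s i)) p := by
    intro p
    simp [L, LinearMap.sum_apply]
  have hLm : ∀ (m : Fin n →₀ ℕ) (a : ℝ), (∀ i, m i ≤ 2 * k + 1) → L (monomial m a) =
      a * ∏ i, ((r i : ℂ) ^ (2 * α i) * ((if m i = 2 * α i then 1 else 0) +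
        if m i = 2 * α i + 1 then (y i : ℂ) else 0)) := by
    intro m a hmi
    rw [hL, ← Finset.prod_congr rfl fun i _ => hm i (m i) (hmi i), Finset.prod_univ_sum,
      Finset.mul_sum, Fintype.piFinset_univ]
    refine Finset.sum_congr rfl fun s _ => ?_
    rw [aeval_monomial, Finset.prod_mul_distrib, Finsupp.prod_fintype _ _ (fun i => pow_zero _)]
    simp only [Complex.coe_algebraMap]
    ring
  have hbound : ‖L f‖ ≤ 2 ^ mdeg α * (4 ^ k * sphereNorm f * 5 ^ k) := by
    rw [hL]
    refine (norm_sum_le _ _).trans ?_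
    have hB : ∀ s : Fin n → Fin (2 * k + 5),
        ‖aeval (fun i => z i (s i)) f‖ ≤ 4 ^ k * sphereNorm f * 5 ^ k := by
      intro s
      refine aux_complex f hf y hy1 _ 5 ?_
      simpa only [hz, sq_abs] using hr
    have h0 : 0 ≤ 4 ^ k * sphereNorm f * 5 ^ k := by
      have := aux_sphere_nonneg f; positivity
    calc ∑ s : Fin n → Fin (2 * k + 5), ‖(∏ i, u i (s i)) * aeval (fun i => z i (s i)) f‖
        ≤ ∑ s : Fin n → Fin (2 * k + 5), (∏ i, ‖u i (s i)‖) * (4 ^ k * sphereNorm f * 5 ^ k) := by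
          refine Finset.sum_le_sum fun s _ => ?_
          rw [norm_mul, norm_prod]
          exact mul_le_mul_of_nonneg_left (hB s) (Finset.prod_nonneg fun i _ => norm_nonneg _)
      _ = (∏ i, ∑ t, ‖u i t‖) * (4 ^ k * sphereNorm f * 5 ^ k) := by
          rw [Finset.prod_univ_sum, Fintype.piFinset_univ, Finset.sum_mul]
      _ ≤ _ := by
          refine mul_le_mul_of_nonneg_right ?_ h0
          rw [aux_mdeg, ← Finset.prod_pow_eq_pow_sum]
          exact Finset.prod_le_prod (fun i _ => Finset.sum_nonneg fun t _ => norm_nonneg _)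
            (fun i _ => hu i)
  have hval : ∀ β ∈ auxS n k, L (g β * monomial (2 • β) (1 : ℝ)) =
      if β = α then (∏ i, (r i : ℂ) ^ (2 * α i)) * ((eval y (g α) : ℝ) : ℂ) else 0 := by
    intro β hβ
    rw [aux_memS] at hβ
    have hml := ((h.1 β).1 (by omega)).1
    have e1 : g β * monomial (2 • β) (1 : ℝ) =
        ∑ e ∈ (g β).support, monomial (e + 2 • β) ((g β).coeff e) := by
      conv_lhs => rw [(g β).as_sum]
      rw [Finset.sum_mul]
      refine Finset.sum_congr rfl fun e _ => ?_
      rw [monomial_mul, mul_one]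
    rw [e1, map_sum]
    have e2 : ∀ e ∈ (g β).support, L (monomial (e + 2 • β) ((g β).coeff e)) =
        if β = α then (∏ i, (r i : ℂ) ^ (2 * α i)) *
          ((((g α).coeff e : ℝ) : ℂ) * ∏ i, (y i : ℂ) ^ e i) else 0 := by
      intro e he
      rw [hLm]
      · split_ifs with hab
        · subst hab
          rw [Finset.prod_mul_distrib]
          have : ∀ i, ((if (e + 2 • β) i = 2 * β i then (1:ℂ) else 0) +
              if (e + 2 • β) i = 2 * β i + 1 then (y i : ℂ) else 0) = (y i : ℂ) ^ e i := by
            intro i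
            have h1 := hml e he i
            have h2 : (e + 2 • β) i = e i + 2 * β i := by simp
            rw [h2]
            rcases (by omega : e i = 0 ∨ e i = 1) with h3 | h3
            · simp [h3]
            · rw [h3, if_neg (by omega), if_pos (by omega)]; simp
          rw [Finset.prod_congr rfl fun i _ => this i]
          ring
        · obtain ⟨i, hi⟩ : ∃ i, β i ≠ α i := by
            by_contra hh
            push Not at hh
            exact hab (Finsupp.ext hh)
          rw [Finset.prod_eq_zero (Finset.mem_univ i), mul_zero]
          have h1 := hml e he i
          have h2 : (e + 2 • β) i = e i + 2 * β i := by simp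
          rw [h2, if_neg (by omega), if_neg (by omega)]
          simp
      · intro i
        have h1 := hml e he i
        have h2 : (e + 2 • β) i = e i + 2 * β i := by simp
        have := hle β hβ i
        omega
    rw [Finset.sum_congr rfl e2]
    split_ifs with hab
    · subst hab
      rw [← Finset.mul_sum, eval_eq']
      push_cast
      rfl
    · simp
  have hLf : L f = (∏ i, (r i : ℂ) ^ (2 * α i)) * ((eval y (g α) : ℝ) : ℂ) := by
    conv_lhs => rw [aux_dec h]
    rw [map_sum, Finset.sum_congr rfl hval, Finset.sum_ite_eq', if_pos ((aux_memS α).2 hα)]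
  rw [hLf, norm_mul, norm_prod, Complex.norm_real, Real.norm_eq_abs, mul_comm] at hbound
  refine le_trans (le_of_eq ?_) hbound
  congr 1
  refine Finset.prod_congr rfl fun i _ => ?_
  rw [norm_pow, Complex.norm_real, Real.norm_eq_abs, pow_mul, sq_abs]

/-- type of a tuple -/
noncomputable def auxType {n a : ℕ} (I : Fin a → Fin n) : Fin n →₀ ℕ :=
  ∑ t, Finsupp.single (I t) 1

lemma auxType_deg {n a : ℕ} (I : Fin a → Fin n) : mdeg (auxType I) = a := by
  have : mdeg (auxType I) = Finsupp.degree (auxType I) := rfl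
  rw [this, auxType, map_sum]
  simp

lemma auxType_prod {n a : ℕ} (I : Fin a → Fin n) :
    ∏ t, (X (I t) : MvPolynomial (Fin n) ℝ) = monomial (auxType I) 1 := by
  rw [auxType, monomial_sum_one]
  rfl

noncomputable def auxO {n : ℕ} (a : ℕ) (α : Fin n →₀ ℕ) : ℕ :=
  open Classical in (Finset.univ.filter fun I : Fin a → Fin n => auxType I = α).card

lemma auxO_eq {n : ℕ} (α : Fin n →₀ ℕ) :
    (∏ i, (α i).factorial) * auxO (mdeg α) α = (mdeg α).factorial := by
  classical
  have h1 := Fintype.sum_pow (fun i : Fin n => (X i : MvPolynomial (Fin n) ℝ)) (mdeg α)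
  rw [Finset.sum_pow_eq_sum_piAntidiag] at h1
  have h2 := congrArg (coeff α) h1
  simp_rw [auxType_prod] at h2
  rw [coeff_sum, coeff_sum] at h2
  have e1 : ∑ I : Fin (mdeg α) → Fin n, coeff α (monomial (auxType I) (1:ℝ)) =
      (auxO (mdeg α) α : ℝ) := by
    simp_rw [coeff_monomial]
    simp [auxO]
  have e2 : ∀ b ∈ Finset.piAntidiag (Finset.univ : Finset (Fin n)) (mdeg α),
      coeff α ((Nat.multinomial Finset.univ b : MvPolynomial (Fin n) ℝ) * ∏ i, X i ^ b i) =
        if b = α then (Nat.multinomial Finset.univ α : ℝ) else 0 := by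
    intro b hb
    have : (∏ i, X i ^ b i : MvPolynomial (Fin n) ℝ) = monomial (Finsupp.equivFunOnFinite.symm b) 1 := by
      rw [monomial_eq, Finsupp.prod_fintype _ _ (fun i => pow_zero _)]
      simp
    rw [this, ← C_eq_coe_nat, coeff_C_mul, coeff_monomial]
    by_cases hba : b = α
    · subst hba; simp
    · rw [if_neg hba, if_neg, mul_zero]
      rintro rfl
      simp at hba
  rw [Finset.sum_congr rfl e2, e1, Finset.sum_ite_eq', if_pos] at h2
  · have h3 : Nat.multinomial Finset.univ α = auxO (mdeg α) α := by exact_mod_cast h2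
    rw [← h3, Nat.multinomial_spec, aux_mdeg]
  · simp [Finset.mem_piAntidiag, aux_mdeg]

lemma auxO_pos {n : ℕ} (α : Fin n →₀ ℕ) : 0 < auxO (mdeg α) α := by
  rcases Nat.eq_zero_or_pos (auxO (mdeg α) α) with h | h
  · have := auxO_eq α
    rw [h, mul_zero] at this
    exact absurd this.symm (Nat.factorial_ne_zero _)
  · exact h

lemma auxO_lower {n : ℕ} (α : Fin n →₀ ℕ) :
    1 ≤ 3 ^ mdeg α * (auxO (mdeg α) α : ℝ) * ∏ i, ((α i : ℝ) / mdeg α) ^ α i := by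
  set a := mdeg α with ha
  have h1 : (∏ i, ((α i).factorial : ℝ)) * auxO a α = a.factorial := by
    exact_mod_cast auxO_eq α
  have h2 : (a : ℝ) ^ a ≤ 3 ^ a * a.factorial := by
    have h := Real.pow_div_factorial_le_exp (x := a) (by positivity) a
    rw [div_le_iff₀ (by positivity)] at h
    refine h.trans (mul_le_mul_of_nonneg_right ?_ (by positivity))
    rw [← Real.exp_one_pow]
    exact pow_le_pow_left₀ (Real.exp_pos _).le Real.exp_one_lt_three.le _
  have h3 : ∏ i, ((α i).factorial : ℝ) ≤ ∏ i, (α i : ℝ) ^ α i := by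
    refine Finset.prod_le_prod (fun i _ => by positivity) fun i _ => ?_
    exact_mod_cast Nat.factorial_le_pow (α i)
  have h4 : ∏ i, ((α i : ℝ) / a) ^ α i = (∏ i, (α i : ℝ) ^ α i) / (a : ℝ) ^ a := by
    simp_rw [div_pow]
    rw [Finset.prod_div_distrib, Finset.prod_pow_eq_pow_sum, ← aux_mdeg]
  have h5 : (0:ℝ) < (a:ℝ) ^ a := by
    rcases Nat.eq_zero_or_pos a with h | h
    · rw [h]; norm_num
    · positivity
  rw [h4, ← mul_div_assoc, le_div_iff₀ h5, one_mul]
  calc (a:ℝ) ^ a ≤ 3 ^ a * a.factorial := h2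
    _ = 3 ^ a * (auxO a α : ℝ) * (∏ i, ((α i).factorial : ℝ)) := by rw [← h1]; ring
    _ ≤ _ := mul_le_mul_of_nonneg_left h3 (by positivity)

lemma aux_main_lower {n k : ℕ} {f : MvPolynomial (Fin n) ℝ}
    {g : (Fin n →₀ ℕ) → MvPolynomial (Fin n) ℝ} (hf : f.IsHomogeneous (2 * k))
    (h : IsMLDecomp (2 * k) f g) (α : Fin n →₀ ℕ) (hα : mdeg α ≤ k) :
    sphereNorm (g α) ≤ auxO (mdeg α) α * (120 ^ k * sphereNorm f) := by
  have hS := aux_sphere_nonneg f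
  refine Real.sSup_le ?_ (by positivity)
  rintro _ ⟨y, hy1, rfl⟩
  let w : Fin n → ℝ := fun i => (α i : ℝ) / mdeg α
  have hw0 : ∀ i, 0 ≤ w i := fun i => by positivity
  have hw : ∑ i, w i ≤ 1 := by
    simp only [w]
    rw [← Finset.sum_div, aux_mdeg]
    push_cast
    exact div_self_le_one _
  let r : Fin n → ℝ := fun i => √(4 * y i ^ 2 + w i)
  have hr2 : ∀ i, r i ^ 2 = 4 * y i ^ 2 + w i := fun i =>
    Real.sq_sqrt (by have := hw0 i; positivity)
  have hr0 : ∀ i, 0 ≤ r i := fun i => Real.sqrt_nonneg _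
  have hyr : ∀ i, |y i| ≤ r i / 2 := by
    intro i
    have h1 : |y i| ^ 2 ≤ (r i / 2) ^ 2 := by
      rw [div_pow, hr2, sq_abs]; have := hw0 i; linarith
    exact le_of_sq_le_sq h1 (by have := hr0 i; positivity)
  have key := aux_extract hf h α hα y r (fun i => y i / r i) hy1 (by
    intro i
    rcases eq_or_ne (r i) 0 with h0 | h0
    · have := hyr i
      rw [h0] at this ⊢
      simp at this
      simp [this]
    · field_simp) (by
    intro i
    rw [abs_div, abs_of_nonneg (hr0 i)]
    refine div_le_of_le_mul₀ (hr0 i) (by norm_num) ?_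
    have := hyr i
    linarith) (by
    simp_rw [hr2]
    rw [Finset.sum_add_distrib, ← Finset.mul_sum, hy1]
    linarith)
  have h1 : ∏ i, (w i) ^ α i ≤ ∏ i, (r i ^ 2) ^ α i := by
    refine Finset.prod_le_prod (fun i _ => pow_nonneg (hw0 i) _) fun i _ => ?_
    refine pow_le_pow_left₀ (hw0 i) ?_ _
    rw [hr2]; have := sq_nonneg (y i); linarith
  have h2 := auxO_lower α
  have h3 : (0:ℝ) ≤ 3 ^ mdeg α * (auxO (mdeg α) α : ℝ) := by positivity
  calc |eval y (g α)| = |eval y (g α)| * 1 := by ring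
    _ ≤ |eval y (g α)| * (3 ^ mdeg α * (auxO (mdeg α) α : ℝ) * ∏ i, (r i ^ 2) ^ α i) := by
        refine mul_le_mul_of_nonneg_left ?_ (abs_nonneg _)
        exact h2.trans (mul_le_mul_of_nonneg_left h1 h3)
    _ = 3 ^ mdeg α * (auxO (mdeg α) α : ℝ) * (|eval y (g α)| * ∏ i, (r i ^ 2) ^ α i) := by ring
    _ ≤ 3 ^ mdeg α * (auxO (mdeg α) α : ℝ) * (2 ^ mdeg α * (4 ^ k * sphereNorm f * 5 ^ k)) :=
        mul_le_mul_of_nonneg_left key h3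
    _ = 6 ^ mdeg α * ((auxO (mdeg α) α : ℝ) * (20 ^ k * sphereNorm f)) := by
        rw [show (6:ℝ) = 3 * 2 by norm_num, show (20:ℝ) = 4 * 5 by norm_num, mul_pow, mul_pow]; ring
    _ ≤ 6 ^ k * ((auxO (mdeg α) α : ℝ) * (20 ^ k * sphereNorm f)) := by
        refine mul_le_mul_of_nonneg_right ?_ (by positivity)
        exact pow_le_pow_right₀ (by norm_num) hα
    _ = _ := by
        rw [show (120:ℝ) = 6 * 20 by norm_num, mul_pow]; ring

def AuxGood {n : ℕ} (k : ℕ) (h : MvPolynomial (Fin n) ℝ) (B : ℝ) : Prop :=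
  ∃ M : Matrix (Fin k → Fin n) (Fin k → Fin n) ℝ, IsMatrixRepr k M h ∧
    ∀ z : (Fin k → Fin n) → ℝ, ∑ I, ∑ J, z I * M I J * z J ≤ B * ∑ I, z I ^ 2

lemma AuxGood.zero {n k : ℕ} : AuxGood k (0 : MvPolynomial (Fin n) ℝ) 0 :=
  ⟨0, ⟨by ext; rfl, by simp⟩, by simp⟩

lemma AuxGood.add {n k : ℕ} {h h' : MvPolynomial (Fin n) ℝ} {B B' : ℝ} (H : AuxGood k h B)
    (H' : AuxGood k h' B') : AuxGood k (h + h') (B + B') := by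
  obtain ⟨M, ⟨hs, hr⟩, hb⟩ := H
  obtain ⟨M', ⟨hs', hr'⟩, hb'⟩ := H'
  refine ⟨M + M', ⟨hs.add hs', fun x => ?_⟩, fun z => ?_⟩
  · rw [map_add, ← hr, ← hr', ← Finset.sum_add_distrib]
    refine Finset.sum_congr rfl fun I _ => ?_
    rw [← Finset.sum_add_distrib]
    refine Finset.sum_congr rfl fun J _ => ?_
    rw [Matrix.add_apply]; ring
  · have := add_le_add (hb z) (hb' z)
    rw [add_mul]
    refine le_trans (le_of_eq ?_) this
    rw [← Finset.sum_add_distrib]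
    refine Finset.sum_congr rfl fun I _ => ?_
    rw [← Finset.sum_add_distrib]
    refine Finset.sum_congr rfl fun J _ => ?_
    rw [Matrix.add_apply]; ring

lemma AuxGood.sum {n k : ℕ} {ι : Type*} (s : Finset ι) (h : ι → MvPolynomial (Fin n) ℝ) (B : ι → ℝ)
    (H : ∀ i ∈ s, AuxGood k (h i) (B i)) : AuxGood k (∑ i ∈ s, h i) (∑ i ∈ s, B i) := by
  classical
  induction s using Finset.induction_on with
  | empty => simpa using AuxGood.zero
  | insert i s hi ih =>
    rw [Finset.sum_insert hi, Finset.sum_insert hi]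
    exact (H i (Finset.mem_insert_self _ _)).add
      (ih fun j hj => H j (Finset.mem_insert_of_mem hj))

lemma AuxGood.mono {n k : ℕ} {h : MvPolynomial (Fin n) ℝ} {B B' : ℝ} (H : AuxGood k h B)
    (hB : B ≤ B') : AuxGood k h B' := by
  obtain ⟨M, hr, hb⟩ := H
  exact ⟨M, hr, fun z => (hb z).trans
    (mul_le_mul_of_nonneg_right hB (Finset.sum_nonneg fun i _ => sq_nonneg _))⟩

lemma AuxGood.smul {n k : ℕ} {h : MvPolynomial (Fin n) ℝ} {B : ℝ} (H : AuxGood k h B)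
    (c : ℝ) (hc : 0 ≤ c) : AuxGood k (C c * h) (c * B) := by
  obtain ⟨M, ⟨hs, hr⟩, hb⟩ := H
  refine ⟨c • M, ⟨hs.smul c, fun x => ?_⟩, fun z => ?_⟩
  · rw [map_mul, eval_C, ← hr, Finset.mul_sum]
    refine Finset.sum_congr rfl fun I _ => ?_
    rw [Finset.mul_sum]
    refine Finset.sum_congr rfl fun J _ => ?_
    rw [Matrix.smul_apply, smul_eq_mul]; ring
  · have := mul_le_mul_of_nonneg_left (hb z) hc
    rw [mul_assoc]
    refine le_trans (le_of_eq ?_) this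
    rw [Finset.mul_sum]
    refine Finset.sum_congr rfl fun I _ => ?_
    rw [Finset.mul_sum]
    refine Finset.sum_congr rfl fun J _ => ?_
    rw [Matrix.smul_apply, smul_eq_mul]; ring

lemma aux_sum_append {n a b : ℕ} (F : (Fin (b + a) → Fin n) → ℝ) :
    ∑ I, F I = ∑ I₂ : Fin a → Fin n, ∑ I₁ : Fin b → Fin n, F (Fin.append I₁ I₂) := by
  rw [Finset.sum_comm, ← Fintype.sum_prod_type']
  exact (Equiv.sum_comp (Fin.appendEquiv b a) F).symm

lemma AuxGood.fold {n a b : ℕ} (h : (Fin a → Fin n) → MvPolynomial (Fin n) ℝ) {B : ℝ}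
    (H : ∀ I₂, AuxGood b (h I₂) B) :
    AuxGood (b + a) (∑ I₂ : Fin a → Fin n, h I₂ * (∏ t, X (I₂ t)) ^ 2) B := by
  choose N hN hb using H
  let M : Matrix (Fin (b + a) → Fin n) (Fin (b + a) → Fin n) ℝ := fun I J =>
    if (fun t => I (Fin.natAdd b t)) = (fun t => J (Fin.natAdd b t)) then
      N (fun t => I (Fin.natAdd b t)) (fun t => I (Fin.castAdd a t)) (fun t => J (Fin.castAdd a t))
    else 0
  have hM : ∀ I₁ I₂ J₁ J₂, M (Fin.append I₁ I₂) (Fin.append J₁ J₂) =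
      if I₂ = J₂ then N I₂ I₁ J₁ else 0 := by
    intro I₁ I₂ J₁ J₂
    simp [M]
  have hform : ∀ z : (Fin (b + a) → Fin n) → ℝ, ∑ I, ∑ J, z I * M I J * z J =
      ∑ I₂ : Fin a → Fin n, ∑ I₁, ∑ J₁, z (Fin.append I₁ I₂) * N I₂ I₁ J₁ * z (Fin.append J₁ I₂) := by
    intro z
    rw [aux_sum_append]
    refine Finset.sum_congr rfl fun I₂ _ => Finset.sum_congr rfl fun I₁ _ => ?_
    rw [aux_sum_append, Finset.sum_comm]
    refine Finset.sum_congr rfl fun J₁ _ => ?_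
    simp_rw [hM]
    simp
  refine ⟨M, ⟨?_, fun x => ?_⟩, fun z => ?_⟩
  · ext I J
    rw [Matrix.transpose_apply]
    simp only [M]
    by_cases hIJ : (fun t => I (Fin.natAdd b t)) = (fun t => J (Fin.natAdd b t))
    · rw [if_pos hIJ, if_pos hIJ.symm, hIJ]
      exact (hN _).1.apply _ _
    · rw [if_neg hIJ, if_neg (fun h => hIJ h.symm)]
  · have := hform (fun I => ∏ t, x (I t))
    have e1 : ∀ I J : Fin (b + a) → Fin n, M I J * (∏ t, x (I t)) * (∏ t, x (J t)) =
      (∏ t, x (I t)) * M I J * (∏ t, x (J t)) := fun I J => by ring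
    simp_rw [e1]
    rw [this, map_sum]
    refine Finset.sum_congr rfl fun I₂ _ => ?_
    rw [map_mul, ← (hN I₂).2 x, map_pow, map_prod, Finset.sum_mul]
    refine Finset.sum_congr rfl fun I₁ _ => ?_
    rw [Finset.sum_mul]
    refine Finset.sum_congr rfl fun J₁ _ => ?_
    rw [Fin.prod_univ_add, Fin.prod_univ_add]
    simp only [Fin.append_left, Fin.append_right, eval_X]
    ring
  · rw [hform, aux_sum_append, Finset.mul_sum]
    exact Finset.sum_le_sum fun I₂ _ => hb I₂ (fun I₁ => z (Fin.append I₁ I₂))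

lemma AuxGood.lam_le {n k : ℕ} {h : MvPolynomial (Fin n) ℝ} {B : ℝ} (H : AuxGood k h B)
    (hB : 0 ≤ B) : Lam k h ≤ B := by
  obtain ⟨M, hr, hb⟩ := H
  have h1 : maxEig M ≤ B := by
    refine Real.sSup_le ?_ hB
    rintro _ ⟨z, hz, rfl⟩
    have := hb z
    rwa [hz, mul_one] at this
  unfold Lam
  by_cases hbdd : BddBelow {y | ∃ M : Matrix (Fin k → Fin n) (Fin k → Fin n) ℝ,
      IsMatrixRepr k M h ∧ y = maxEig M}
  · exact (csInf_le hbdd ⟨M, hr, rfl⟩).trans h1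
  · rw [Real.sInf_of_not_bddBelow hbdd]; exact hB

lemma aux_form_le {n k : ℕ} (M : Matrix (Fin k → Fin n) (Fin k → Fin n) ℝ)
    (z : (Fin k → Fin n) → ℝ) : ∑ I, ∑ J, z I * M I J * z J ≤ maxEig M * ∑ I, z I ^ 2 := by
  have hbdd : BddAbove {y | ∃ z : (Fin k → Fin n) → ℝ, (∑ I, z I ^ 2) = 1 ∧
      y = ∑ I, ∑ J, z I * M I J * z J} := by
    refine ⟨∑ I, ∑ J, |M I J|, ?_⟩
    rintro _ ⟨z, hz, rfl⟩
    have h1 : ∀ I, |z I| ≤ 1 := by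
      intro I
      rw [← sq_le_one_iff_abs_le_one, ← hz]
      exact Finset.single_le_sum (f := fun i => z i ^ 2) (fun i _ => sq_nonneg _)
        (Finset.mem_univ I)
    refine Finset.sum_le_sum fun I _ => Finset.sum_le_sum fun J _ => ?_
    refine (le_abs_self _).trans ?_
    rw [abs_mul, abs_mul]
    calc |z I| * |M I J| * |z J| ≤ 1 * |M I J| * 1 := by
          gcongr
          · exact h1 I
          · exact h1 J
      _ = _ := by ring
  by_cases h0 : ∑ I, z I ^ 2 = 0
  · have hz : ∀ I, z I = 0 := by
      intro I
      have := (Finset.sum_eq_zero_iff_of_nonneg (fun i _ => sq_nonneg (z i))).1 h0 I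
        (Finset.mem_univ I)
      simpa using this
    simp [hz]
  · have hpos : 0 < ∑ i, z i ^ 2 :=
      lt_of_le_of_ne (Finset.sum_nonneg fun i _ => sq_nonneg _) (Ne.symm h0)
    set s := ∑ i, z i ^ 2 with hs
    have hsq : √s ^ 2 = s := Real.sq_sqrt hpos.le
    have hsp : 0 < √s := Real.sqrt_pos.2 hpos
    have hu : ∑ i, (z i / √s) ^ 2 = 1 := by
      simp_rw [div_pow]
      rw [← Finset.sum_div, hsq, ← hs, div_self h0]
    have h1 : ∑ I, ∑ J, (z I / √s) * M I J * (z J / √s) ≤ maxEig M :=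
      le_csSup hbdd ⟨fun I => z I / √s, hu, rfl⟩
    have h2 : ∑ I, ∑ J, (z I / √s) * M I J * (z J / √s) = (∑ I, ∑ J, z I * M I J * z J) / s := by
      rw [Finset.sum_div]
      refine Finset.sum_congr rfl fun I _ => ?_
      rw [Finset.sum_div]
      refine Finset.sum_congr rfl fun J _ => ?_
      have h3 : (z I / √s) * M I J * (z J / √s) = z I * M I J * z J / √s ^ 2 := by
        field_simp
      rw [h3, hsq]
    rw [h2, div_le_iff₀ hpos] at h1
    exact h1

lemma aux_repr_zero {n k : ℕ} : IsMatrixRepr (n := n) k 0 0 := ⟨by ext; rfl, by simp⟩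

lemma aux_repr_exists {n k : ℕ} (h : MvPolynomial (Fin n) ℝ) (hh : h.IsHomogeneous (2 * k)) :
    ∃ M, IsMatrixRepr k M h := by
  classical
  have hmono : ∀ m ∈ h.support, ∃ M, IsMatrixRepr k M (monomial m (h.coeff m)) := by
    intro m hm
    have hdeg : mdeg m = k + k := by
      have := hh.degree_eq_sum_deg_support hm
      rw [← two_mul, this]
      rfl
    obtain ⟨K, hK⟩ : ∃ K : Fin (k + k) → Fin n, auxType K = m := by
      have := auxO_pos m
      rw [hdeg] at this
      obtain ⟨K, hK⟩ := Finset.card_pos.1 this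
      exact ⟨K, by simpa using hK⟩
    let A : Fin k → Fin n := fun t => K (Fin.castAdd k t)
    let A' : Fin k → Fin n := fun t => K (Fin.natAdd k t)
    let c := h.coeff m
    refine ⟨Matrix.of fun I J => (if I = A ∧ J = A' then c / 2 else 0) + (if J = A ∧ I = A' then c / 2 else 0),
      ?_, fun x => ?_⟩
    · ext I J
      rw [Matrix.transpose_apply, Matrix.of_apply, Matrix.of_apply, add_comm]
    · have e1 : eval x (monomial m (h.coeff m)) = c * ((∏ t, x (A t)) * ∏ t, x (A' t)) := by
        have := congrArg (eval x) (auxType_prod K)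
        rw [hK, map_prod, Fin.prod_univ_add] at this
        simp only [eval_X] at this
        have e : monomial m (h.coeff m) = C c * monomial m (1:ℝ) := by
          rw [C_mul_monomial, mul_one]
        rw [e, map_mul, eval_C, ← this]
      rw [e1]
      simp only [Matrix.of_apply, add_mul, Finset.sum_add_distrib, ite_and, ite_mul, zero_mul]
      have s1 : ∑ I : Fin k → Fin n, ∑ J : Fin k → Fin n, (if I = A then if J = A' then
          c / 2 * (∏ t, x (I t)) * (∏ t, x (J t)) else 0 else 0) =
          c / 2 * (∏ t, x (A t)) * (∏ t, x (A' t)) := by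
        rw [Finset.sum_comm]
        simp
      have s2 : ∑ I : Fin k → Fin n, ∑ J : Fin k → Fin n, (if J = A then if I = A' then
          c / 2 * (∏ t, x (I t)) * (∏ t, x (J t)) else 0 else 0) =
          c / 2 * (∏ t, x (A' t)) * (∏ t, x (A t)) := by
        simp
      rw [s1, s2]
      ring
  rw [h.as_sum]
  have key : ∀ (F : (Fin n →₀ ℕ) → MvPolynomial (Fin n) ℝ) (s : Finset (Fin n →₀ ℕ)),
      (∀ m ∈ s, ∃ M, IsMatrixRepr k M (F m)) → ∃ M, IsMatrixRepr k M (∑ m ∈ s, F m) := by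
    intro F s
    induction s using Finset.induction_on with
    | empty => intro _; exact ⟨0, by simpa using aux_repr_zero⟩
    | insert i s hi ih =>
      intro H
      obtain ⟨M, hs, hr⟩ := H i (Finset.mem_insert_self _ _)
      obtain ⟨M', hs', hr'⟩ := ih fun j hj => H j (Finset.mem_insert_of_mem hj)
      rw [Finset.sum_insert hi]
      refine ⟨M + M', hs.add hs', fun x => ?_⟩
      rw [map_add, ← hr, ← hr', ← Finset.sum_add_distrib]
      refine Finset.sum_congr rfl fun I _ => ?_
      rw [← Finset.sum_add_distrib]
      refine Finset.sum_congr rfl fun J _ => ?_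
      rw [Matrix.add_apply]; ring
  exact key _ _ hmono

lemma aux_good_of_lam {n k : ℕ} (h : MvPolynomial (Fin n) ℝ) (hh : h.IsHomogeneous (2 * k)) (B : ℝ)
    (hB : Lam k h < B) : AuxGood k h B := by
  obtain ⟨M₀, hM₀⟩ := aux_repr_exists h hh
  obtain ⟨_, ⟨M, hM, rfl⟩, hlt⟩ := exists_lt_of_csInf_lt
    (s := {y | ∃ M : Matrix (Fin k → Fin n) (Fin k → Fin n) ℝ, IsMatrixRepr k M h ∧ y = maxEig M})
    ⟨maxEig M₀, M₀, hM₀, rfl⟩ hB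
  exact AuxGood.mono ⟨M, hM, aux_form_le M⟩ hlt.le

lemma aux_decomp2 {n k : ℕ} {f : MvPolynomial (Fin n) ℝ}
    {g : (Fin n →₀ ℕ) → MvPolynomial (Fin n) ℝ} (h : IsMLDecomp (2 * k) f g) :
    f = ∑ a ∈ Finset.range (k + 1), ∑ I : Fin a → Fin n,
      C ((1:ℝ) / auxO a (auxType I)) * g (auxType I) * (∏ t, X (I t)) ^ 2 := by
  classical
  conv_lhs => rw [aux_dec h]
  rw [← Finset.sum_fiberwise_of_maps_to (s := auxS n k) (t := Finset.range (k + 1)) (g := mdeg)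
    (fun β hβ => by rw [Finset.mem_range]; have := (aux_memS β).1 hβ; omega)]
  refine Finset.sum_congr rfl fun a ha => ?_
  rw [Finset.mem_range] at ha
  rw [← Finset.sum_fiberwise_of_maps_to (s := (Finset.univ : Finset (Fin a → Fin n)))
    (t := (auxS n k).filter fun β => mdeg β = a) (g := auxType)
    (fun I _ => by
      rw [Finset.mem_filter, aux_memS, auxType_deg]; exact ⟨by omega, rfl⟩)]
  refine Finset.sum_congr rfl fun β hβ => ?_
  obtain ⟨-, hβa⟩ := Finset.mem_filter.1 hβ
  have e1 : ∀ I ∈ (Finset.univ : Finset (Fin a → Fin n)).filter (fun I => auxType I = β),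
      C ((1:ℝ) / auxO a (auxType I)) * g (auxType I) * (∏ t, X (I t)) ^ 2 =
      C ((1:ℝ) / auxO a β) * (g β * monomial (2 • β) (1:ℝ)) := by
    intro I hI
    have hI' : auxType I = β := by simpa using hI
    rw [auxType_prod, hI', monomial_pow, one_pow, mul_assoc]
  rw [Finset.sum_congr rfl e1, Finset.sum_const]
  have e2 : ((Finset.univ : Finset (Fin a → Fin n)).filter (fun I => auxType I = β)).card =
      auxO a β := by
    unfold auxO
    congr
  rw [e2, nsmul_eq_mul, ← mul_assoc, ← C_eq_coe_nat, ← C_mul]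
  have hp : (auxO a β : ℝ) ≠ 0 := by
    have := auxO_pos β
    rw [hβa] at this
    exact_mod_cast this.ne'
  rw [mul_one_div_cancel hp, C_1, one_mul]

theorem stmt4 : ∃ C : ℝ, C > 0 ∧
    ∀ (n d : ℕ) (f : MvPolynomial (Fin n) ℝ)
      (g : (Fin n →₀ ℕ) → MvPolynomial (Fin n) ℝ) (κ : ℝ),
      Even d → f.IsHomogeneous d → IsMLDecomp d f g → 0 ≤ κ →
      (∀ α : Fin n →₀ ℕ, mdeg α ≤ d / 2 → g α ≠ 0 →
        Lam (d / 2 - mdeg α) (g α) ≤ κ * sphereNorm (g α)) →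
      Lam (d / 2) f ≤ C ^ d * κ * sphereNorm f := by
  refine ⟨16, by norm_num, ?_⟩
  intro n d f g κ hd hf hdec hκ hyp
  obtain ⟨k, rfl⟩ := hd
  rw [← two_mul] at *
  have hk2 : 2 * k / 2 = k := by omega
  rw [hk2] at *
  have hS := aux_sphere_nonneg f
  set B := κ * (120 ^ k * sphereNorm f) with hBdef
  have hB0 : 0 ≤ B := by positivity
  have hgood : ∀ ε : ℝ, 0 < ε → AuxGood k f ((k + 1 : ℕ) * (B + ε)) := by
    intro ε hε
    have hsum : ∑ a ∈ Finset.range (k + 1), (B + ε) = (k + 1 : ℕ) * (B + ε) := by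
      rw [Finset.sum_const, Finset.card_range, nsmul_eq_mul]
    rw [← hsum, aux_decomp2 hdec]
    refine AuxGood.sum _ _ _ fun a ha => ?_
    have hak : a ≤ k := by rw [Finset.mem_range] at ha; omega
    obtain ⟨b, rfl⟩ : ∃ b, k = b + a := ⟨k - a, by omega⟩
    refine AuxGood.fold _ fun I => ?_
    have hdeg : mdeg (auxType I) = a := auxType_deg I
    set α := auxType I with hαdef
    have hOpos : 0 < (auxO a α : ℝ) := by
      have := auxO_pos α
      rw [hdeg] at this
      exact_mod_cast this
    have hO1 : 1 ≤ (auxO a α : ℝ) := by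
      have := auxO_pos α
      rw [hdeg] at this
      exact_mod_cast this
    have hg : AuxGood b (g α) (κ * sphereNorm (g α) + ε) := by
      by_cases hg0 : g α = 0
      · rw [hg0]
        refine AuxGood.zero.mono ?_
        have := aux_sphere_nonneg (0 : MvPolynomial (Fin n) ℝ)
        positivity
      · have h1 := hyp α (by omega) hg0
        have h2 := ((hdec.1 α).1 (by omega)).2
        rw [hdeg] at h1 h2
        rw [show 2 * (b + a) / 2 - a = b by omega] at h1
        rw [show 2 * (b + a) - 2 * a = 2 * b by omega] at h2
        exact aux_good_of_lam _ h2 _ (by linarith)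
    refine (hg.smul (1 / (auxO a α : ℝ)) (by positivity)).mono ?_
    have hlow := aux_main_lower hf hdec α (by omega)
    rw [hdeg] at hlow
    rw [one_div, inv_mul_le_iff₀ hOpos]
    have h3 := mul_le_mul_of_nonneg_left hlow hκ
    have h4 : κ * (auxO a α * (120 ^ (b + a) * sphereNorm f)) = auxO a α * B := by
      rw [hBdef]; ring
    rw [h4] at h3
    nlinarith
  have hlam : Lam k f ≤ (k + 1 : ℕ) * B := by
    refine le_of_forall_pos_le_add fun δ hδ => ?_
    have h1 := (hgood (δ / (k + 1 : ℕ)) (by positivity)).lam_le (by positivity)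
    refine h1.trans (le_of_eq ?_)
    have : ((k + 1 : ℕ) : ℝ) ≠ 0 := by positivity
    field_simp
  refine hlam.trans ?_
  have h5 : ((k + 1 : ℕ) : ℝ) ≤ 2 ^ k := by
    exact_mod_cast Nat.lt_two_pow_self
  calc ((k + 1 : ℕ) : ℝ) * B ≤ 2 ^ k * B := mul_le_mul_of_nonneg_right h5 hB0
    _ = 240 ^ k * (κ * sphereNorm f) := by
        rw [hBdef, show (240:ℝ) = 2 * 120 by norm_num, mul_pow]; ring
    _ ≤ 256 ^ k * (κ * sphereNorm f) := by
        refine mul_le_mul_of_nonneg_right ?_ (by positivity)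
        exact pow_le_pow_left₀ (by norm_num) (by norm_num) k
    _ = _ := by
        rw [pow_mul, show (16:ℝ) ^ 2 = 256 by norm_num]; ring
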